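/- Let G = ℤ/2ℤ * ℤ/2ℤ = ⟨a,b | a² = b² = 1⟩ act on F(2^G) by the left shift. There is no Borel relation < on F(2^G) such that for each orbit E of the action, the restriction of < to E is a linear order of order type ℤ in which, for each x ∈ E, the immediate successor and immediate predecessor of x under this order are (in some order) a·x and b·x. -/

import Mathlib

open Multiplicative

section Defs

variable {G : Type*} [Group G]

/-- The left shift action of `g : G` on `x : G → Bool` (`2^G` with `2 = Bool`):
`(g · x)(h) = x (g⁻¹ h)`. -/
def shiftMap (g : G) (x : G → Bool) : G → Bool := fun h => x (g⁻¹ * h)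

/-- The free part `F(2^G)` of the left shift action. -/
def FreePart (G : Type*) [Group G] : Set (G → Bool) :=
  {x | ∀ g : G, g ≠ 1 → shiftMap g x ≠ x}

/-- Adjacency in the shift graph of the marked group `(G, S)`: distinct `x, y ∈ F(2^G)`
are adjacent iff `y = s · x` for some `s ∈ S`. -/
def ShiftAdj (S : Set G) (x y : FreePart G) : Prop :=
  x ≠ y ∧ ∃ s ∈ S, (y : G → Bool) = shiftMap s (x : G → Bool)

/-- Adjacency in the Cayley graph of `(G, S)`: distinct `g, h` are adjacent iff
`h = s * g` for some `s ∈ S`. -/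
def CayleyAdj (S : Set G) (g h : G) : Prop :=
  g ≠ h ∧ ∃ s ∈ S, h = s * g

/-- `(G, S)` is a marked group: `S` is a finite symmetric generating set
not containing the identity. -/
def IsMarkedGroup (S : Set G) : Prop :=
  S.Finite ∧ (∀ s ∈ S, s⁻¹ ∈ S) ∧ (1 : G) ∉ S ∧ Subgroup.closure S = ⊤

end Defs

/-- A graph (given by its adjacency relation) has an `n`-coloring. -/
def HasColoring {X : Type*} (Adj : X → X → Prop) (n : ℕ) : Prop :=
  ∃ c : X → Fin n, ∀ x y, Adj x y → c x ≠ c y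

/-- The chromatic number: the least `n` admitting an `n`-coloring. -/
noncomputable def chromatic {X : Type*} (Adj : X → X → Prop) : ℕ :=
  sInf {n | HasColoring Adj n}

/-- A graph on a measurable space has a Borel `n`-coloring. -/
def HasBorelColoring {X : Type*} [MeasurableSpace X] (Adj : X → X → Prop) (n : ℕ) : Prop :=
  ∃ c : X → Fin n, Measurable c ∧ ∀ x y, Adj x y → c x ≠ c y

/-- The Borel chromatic number: the least `n` admitting a Borel `n`-coloring. -/
noncomputable def borelChromatic {X : Type*} [MeasurableSpace X] (Adj : X → X → Prop) : ℕ :=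
  sInf {n | HasBorelColoring Adj n}
/-- The free product `ℤ/2ℤ * ℤ/2ℤ = ⟨a, b ∣ a² = b² = 1⟩`. -/
abbrev D2 : Type := Monoid.Coprod (Multiplicative (ZMod 2)) (Multiplicative (ZMod 2))

/-- The generator `a` of the first factor of `ℤ/2ℤ * ℤ/2ℤ`. -/
def genA : D2 := Monoid.Coprod.inl (ofAdd (1 : ZMod 2))

/-- The generator `b` of the second factor of `ℤ/2ℤ * ℤ/2ℤ`. -/
def genB : D2 := Monoid.Coprod.inr (ofAdd (1 : ZMod 2))

/-- `x` and `y` lie in the same orbit of the left shift action of `ℤ/2ℤ * ℤ/2ℤ`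
on its free part. -/
def SameOrbit (x y : FreePart D2) : Prop :=
  ∃ g : D2, shiftMap g (x : D2 → Bool) = (y : D2 → Bool)

/-- `y` is the immediate successor of `x` (within its orbit) for the relation `r`:
`x r y` and no point of the orbit lies strictly between them. -/
def OrbCovers (r : FreePart D2 → FreePart D2 → Prop) (x y : FreePart D2) : Prop :=
  r x y ∧ ¬ ∃ z : FreePart D2, SameOrbit x z ∧ r x z ∧ r z y

lemma shiftMap_mul' {G : Type*} [Group G] (g h : G) (x : G → Bool) :
    shiftMap (g * h) x = shiftMap g (shiftMap h x) := by
  funext k; simp [shiftMap, mul_assoc]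

lemma shiftMap_one' {G : Type*} [Group G] (x : G → Bool) : shiftMap 1 x = x := by
  funext k; simp [shiftMap]

lemma continuous_shiftMap' {G : Type*} [Group G] (g : G) :
    Continuous (shiftMap g : (G → Bool) → (G → Bool)) := by
  unfold shiftMap; fun_prop

/-- The shift by `g` as a homeomorphism. -/
def shiftHomeo {G : Type*} [Group G] (g : G) : (G → Bool) ≃ₜ (G → Bool) where
  toFun := shiftMap g
  invFun := shiftMap g⁻¹
  left_inv x := by rw [← shiftMap_mul', inv_mul_cancel, shiftMap_one']
  right_inv x := by rw [← shiftMap_mul', mul_inv_cancel, shiftMap_one']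
  continuous_toFun := continuous_shiftMap' g
  continuous_invFun := continuous_shiftMap' g⁻¹

lemma tendsto_shift_residual {G : Type*} [Group G] (g : G) :
    Filter.Tendsto (shiftMap g) (residual (G → Bool)) (residual (G → Bool)) :=
  tendsto_residual_of_isOpenMap (shiftHomeo g).continuous (shiftHomeo g).isOpenMap

lemma genA_sq : genA * genA = 1 := by
  have : (ofAdd (1 : ZMod 2)) * ofAdd (1 : ZMod 2) = 1 := by decide
  rw [genA, ← map_mul, this, map_one]

lemma genB_sq : genB * genB = 1 := by
  have : (ofAdd (1 : ZMod 2)) * ofAdd (1 : ZMod 2) = 1 := by decide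
  rw [genB, ← map_mul, this, map_one]

instance countable_D2 : Countable D2 := by
  have : Countable (FreeMonoid (Multiplicative (ZMod 2) ⊕ Multiplicative (ZMod 2))) :=
    inferInstanceAs (Countable (List (Multiplicative (ZMod 2) ⊕ Multiplicative (ZMod 2))))
  exact Monoid.Coprod.mk_surjective.countable

/-- The hom from `ZMod 2` given by an involution in a group. -/
def invHom {H : Type*} [Group H] (s : H) (hs : s * s = 1) : Multiplicative (ZMod 2) →* H where
  toFun z := if z = 1 then 1 else s
  map_one' := by simp
  map_mul' := by
    have key : ∀ z : Multiplicative (ZMod 2), z = 1 ∨ z = ofAdd (1 : ZMod 2) := by decide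
    have h1 : (ofAdd (1 : ZMod 2)) * ofAdd (1 : ZMod 2) = 1 := by decide
    intro x y
    rcases key x with rfl | rfl <;> rcases key y with rfl | rfl <;> simp [h1, hs]

lemma invHom_apply {H : Type*} [Group H] (s : H) (hs : s * s = 1) :
    invHom s hs (ofAdd 1) = s := by
  simp [invHom]

/-- The map to the infinite dihedral group. -/
def toDih : D2 →* DihedralGroup 0 :=
  Monoid.Coprod.lift (invHom (DihedralGroup.sr 0) (by simp))
    (invHom (DihedralGroup.sr 1) (by simp))

lemma toDih_A : toDih genA = DihedralGroup.sr (0 : ZMod 0) := by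
  simp [toDih, genA, invHom_apply]

lemma toDih_B : toDih genB = DihedralGroup.sr (1 : ZMod 0) := by
  simp [toDih, genB, invHom_apply]

lemma refl_injective : Function.Injective (fun n : ℕ => (genA * genB) ^ n * genA) := by
  intro m n h
  have := congrArg toDih (mul_right_cancel h)
  simp [toDih_A, toDih_B] at this
  exact_mod_cast this

instance infinite_D2 : Infinite D2 := Infinite.of_injective _ refl_injective

lemma freePart_residual : FreePart D2 ∈ residual (D2 → Bool) := by
  have : FreePart D2 = ⋂ g : D2, ⋂ _ : g ≠ 1, {x | shiftMap g x ≠ x} := by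
    ext x; simp [FreePart]
  rw [this, countable_iInter_mem]
  intro g
  rw [countable_iInter_mem]
  intro hg
  refine residual_of_dense_open (isOpen_ne_fun (continuous_shiftMap' g) continuous_id) ?_
  rw [dense_iff_inter_open]
  rintro U hU ⟨f, hf⟩
  obtain ⟨I, u, hu, hI⟩ := isOpen_pi_iff.1 hU f hf
  classical
  obtain ⟨h, hh⟩ := Infinite.exists_notMem_finset (I ∪ I.image (g * ·))
  simp only [Finset.mem_union, Finset.mem_image, not_or, not_exists, not_and] at hh
  have h2 : g⁻¹ * h ∉ I := fun hc => hh.2 _ hc (by simp)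
  have h3 : g⁻¹ * h ≠ h := by simpa using hg
  refine ⟨fun k => if k = h then true else if k = g⁻¹ * h then false else f k, hI ?_, ?_⟩
  · intro k hk
    have hk' : k ∈ I := hk
    have e1 : k ≠ h := by rintro rfl; exact hh.1 hk'
    have e2 : k ≠ g⁻¹ * h := by rintro rfl; exact h2 hk'
    simpa [e1, e2] using (hu k hk').2
  · intro hc
    have := congrFun hc h
    simp [shiftMap, hg] at this

lemma freePart_measurable : MeasurableSet (FreePart D2) := by
  have : FreePart D2 = ⋂ g : D2, ⋂ _ : g ≠ 1, {x | shiftMap g x ≠ x} := by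
    ext x; simp [FreePart]
  rw [this]
  exact MeasurableSet.iInter fun g => MeasurableSet.iInter fun _ =>
    (isOpen_ne_fun (continuous_shiftMap' g) continuous_id).measurableSet

/-- No Borel subset of the free part is flipped by both generators. -/
lemma no_flip (A : Set (D2 → Bool)) (hA : MeasurableSet A)
    (hFa : ∀ x ∈ FreePart D2, shiftMap genA x ∈ FreePart D2 ∧ (shiftMap genA x ∈ A ↔ x ∉ A))
    (hFb : ∀ x ∈ FreePart D2, shiftMap genB x ∈ FreePart D2 ∧ (shiftMap genB x ∈ A ↔ x ∉ A)) :
    False := by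
  have key : ∀ n : ℕ, ∀ x ∈ FreePart D2,
      shiftMap ((genA * genB) ^ n * genA) x ∈ FreePart D2 ∧
      (shiftMap ((genA * genB) ^ n * genA) x ∈ A ↔ x ∉ A) := by
    intro n x hx
    induction n with
    | zero => simpa using hFa x hx
    | succ n ih =>
      rw [pow_succ', mul_assoc, mul_assoc, shiftMap_mul', shiftMap_mul']
      have h1 := hFb _ ih.1
      have h2 := hFa _ h1.1
      exact ⟨h2.1, by rw [h2.2, h1.2, ih.2]; tauto⟩
  obtain ⟨U, hU, hAU⟩ := hA.baireMeasurableSet.residualEq_isOpen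
  have ev : ∀ n : ℕ, ∀ᶠ x in residual (D2 → Bool),
      (shiftMap ((genA * genB) ^ n * genA) x ∈ U ↔ x ∉ U) := by
    intro n
    have hAU' : ∀ᶠ x in residual (D2 → Bool), (x ∈ A ↔ x ∈ U) := Filter.eventuallyEq_set.1 hAU
    filter_upwards [hAU', (tendsto_shift_residual ((genA * genB) ^ n * genA)).eventually hAU',
      freePart_residual] with x h1 h2 h3
    rw [← h1, ← h2]; exact (key n x h3).2
  have hne : U.Nonempty := by
    by_contra hc
    rw [Set.not_nonempty_iff_eq_empty] at hc
    obtain ⟨x, hx⟩ := (dense_of_mem_residual (ev 0)).nonempty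
    simp [hc] at hx
  obtain ⟨f, hf⟩ := hne
  obtain ⟨I, u, hu, hI⟩ := isOpen_pi_iff.1 hU f hf
  classical
  obtain ⟨n, hn⟩ : ∃ n : ℕ, (genA * genB) ^ n * genA ∉ (I ×ˢ I).image (fun p => p.1 * p.2⁻¹) := by
    by_contra hc
    push Not at hc
    exact (Set.infinite_range_of_injective refl_injective)
      ((Finset.finite_toSet _).subset (Set.range_subset_iff.2 hc))
  set h := (genA * genB) ^ n * genA with hh
  have hn' : ∀ k ∈ I, h⁻¹ * k ∉ I := fun k hk hk2 =>
    hn (Finset.mem_image.2 ⟨(k, h⁻¹ * k), by simp [hk, hk2], by simp⟩)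
  have hW : IsOpen (U ∩ shiftMap h ⁻¹' U) := hU.inter (hU.preimage (continuous_shiftMap' h))
  obtain ⟨x, ⟨hx1, hx2⟩, hx3⟩ := (dense_of_mem_residual (ev n)).inter_open_nonempty _ hW (by
    refine ⟨fun k => if k ∈ I then f k else f (h * k), hI ?_, hI ?_⟩
    · intro k hk
      have hk' : k ∈ I := hk
      simpa [hk'] using (hu k hk').2
    · intro k hk
      have hk' : k ∈ I := hk
      simpa [shiftMap, hn' k hk'] using (hu k hk').2)
  exact hx3.1 hx2 hx1

/-- There is no Borel relation `<` on `F(2^{ℤ/2ℤ * ℤ/2ℤ})` whose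
restriction to each orbit `E` of the shift action is a linear order of order type `ℤ`
in which, for each `x ∈ E`, the immediate successor and immediate predecessor of `x`
are (in some order) `a·x` and `b·x`. -/
theorem no_borel_Z_ordering :
    ¬ ∃ r : FreePart D2 → FreePart D2 → Prop,
      MeasurableSet {p : FreePart D2 × FreePart D2 | r p.1 p.2} ∧
      -- the restriction of `r` to each orbit is a (strict) linear order:
      (∀ x, ¬ r x x) ∧
      (∀ x y z, SameOrbit x y → SameOrbit y z → r x y → r y z → r x z) ∧
      (∀ x y, SameOrbit x y → x ≠ y → r x y ∨ r y x) ∧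
      -- each point's immediate successor and predecessor exist and are `a·x` and `b·x`
      -- in some order (for a linear order on an orbit of `⟨a,b⟩` this forces order
      -- type `ℤ`):
      (∀ x : FreePart D2, ∃ ya yb : FreePart D2,
        (ya : D2 → Bool) = shiftMap genA (x : D2 → Bool) ∧
        (yb : D2 → Bool) = shiftMap genB (x : D2 → Bool) ∧
        ((OrbCovers r x ya ∧ OrbCovers r yb x) ∨
         (OrbCovers r x yb ∧ OrbCovers r ya x))) := by
  rintro ⟨r, hr, irr, tr, -, hs⟩
  choose ya yb hya hyb hc using hs
  have so : ∀ g (x y : FreePart D2), (y : D2 → Bool) = shiftMap g x → SameOrbit x y :=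
    fun g x y h => ⟨g, h.symm⟩
  have aa : ∀ x, ya (ya x) = x := fun x => Subtype.ext (by
    rw [hya, hya, ← shiftMap_mul', genA_sq, shiftMap_one'])
  have bb : ∀ x, yb (yb x) = x := fun x => Subtype.ext (by
    rw [hyb, hyb, ← shiftMap_mul', genB_sq, shiftMap_one'])
  have asa : ∀ x, r x (ya x) → r (ya x) x → False := fun x h1 h2 =>
    irr x (tr x (ya x) x (so _ _ _ (hya x)) (so genA _ _ (by rw [← hya, aa])) h1 h2)
  have asb : ∀ x, r x (yb x) → r (yb x) x → False := fun x h1 h2 =>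
    irr x (tr x (yb x) x (so _ _ _ (hyb x)) (so genB _ _ (by rw [← hyb, bb])) h1 h2)
  have cs : ∀ x, (r x (ya x) ∧ r (yb x) x) ∨ (r x (yb x) ∧ r (ya x) x) := fun x =>
    (hc x).imp (fun h => ⟨h.1.1, h.2.1⟩) (fun h => ⟨h.1.1, h.2.1⟩)
  have fa : ∀ x, r (ya x) (ya (ya x)) ↔ ¬ r x (ya x) := by
    intro x
    rw [aa]
    have := asa x
    have := cs x
    tauto
  have fb : ∀ x, r (yb x) (ya (yb x)) ↔ ¬ r x (ya x) := by
    intro x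
    have h1 := asa x
    have h2 := cs x
    have h3 := asb x
    have h4 := asa (yb x)
    have h5 := cs (yb x)
    rw [bb] at h5
    tauto
  have mya : Measurable ya := by
    refine Measurable.subtype_mk (f := fun x => (ya x : D2 → Bool)) ?_
    simp only [hya]
    exact (continuous_shiftMap' genA).measurable.comp measurable_subtype_coe
  have mA : MeasurableSet {x | r x (ya x)} := (measurable_id.prodMk mya) hr
  refine no_flip (Subtype.val '' {x | r x (ya x)}) (freePart_measurable.subtype_image mA) ?_ ?_
  · intro x hx
    have e := hya ⟨x, hx⟩
    simp only at e
    rw [← e]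
    refine ⟨Subtype.coe_prop _, ?_⟩
    rw [Subtype.val_injective.mem_set_image]
    refine (fa ⟨x, hx⟩).trans (not_congr ?_)
    exact (Subtype.val_injective.mem_set_image (s := {x | r x (ya x)})
      (a := (⟨x, hx⟩ : FreePart D2))).symm
  · intro x hx
    have e := hyb ⟨x, hx⟩
    simp only at e
    rw [← e]
    refine ⟨Subtype.coe_prop _, ?_⟩
    rw [Subtype.val_injective.mem_set_image]
    refine (fb ⟨x, hx⟩).trans (not_congr ?_)
    exact (Subtype.val_injective.mem_set_image (s := {x | r x (ya x)})
      (a := (⟨x, hx⟩ : FreePart D2))).symm
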